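/- arXiv:2303.05030 — 2 statements merged into one kernel-verified Lean document; each statement's English description precedes it below -/
import Mathlib

section
/- Fix an integer n ≥ 1 and let p : Fin m → ℂ be a finite family of complex numbers. Let K be the subfield of ℂ generated over ℚ̄ by all n-fold products p i₁ * p i₂ * ⋯ * p iₙ (over all functions (i₁,…,iₙ) : Fin n → Fin m), and let L be the subfield of ℂ generated over ℚ̄ by the elements p i (for i ∈ Fin m). Then L is an algebraic extension of K, and consequently the transcendence degree of K over ℚ equals the transcendence degree of L over ℚ. -/
open Cardinal in
/-- The transcendence degree of an `R`-algebra `A`: the supremum of the cardinalities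
of the algebraically independent subsets of `A` over `R`. -/
noncomputable def trdeg (R A : Type*) [CommRing R] [CommRing A] [Algebra R A] : Cardinal :=
  ⨆ s : { s : Set A // AlgebraicIndependent R ((↑) : s → A) }, #s.1

/-- `ℚ̄`: the set of complex numbers that are algebraic over `ℚ`. -/
def Qbar : Set ℂ := {x : ℂ | IsAlgebraic ℚ x}

theorem trdeg_eq_algebra_trdeg (R A : Type*) [CommRing R] [CommRing A] [Algebra R A] :
    trdeg R A = Algebra.trdeg R A := rfl

theorem stmt_2 (n m : ℕ) (hn : 1 ≤ n) (p : Fin m → ℂ) (K L : Subfield ℂ)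
    (hK : K = Subfield.closure (Qbar ∪ {z : ℂ | ∃ f : Fin n → Fin m, z = ∏ t : Fin n, p (f t)}))
    (hL : L = Subfield.closure (Qbar ∪ Set.range p)) :
    (∀ x : ℂ, x ∈ L → IsAlgebraic K x) ∧ trdeg ℚ K = trdeg ℚ L := by
  have hKL : K ≤ L := by
    rw [hK, Subfield.closure_le, Set.union_subset_iff]
    refine ⟨fun x hx ↦ hL ▸ Subfield.subset_closure (.inl hx), ?_⟩
    rintro _ ⟨f, rfl⟩
    exact prod_mem fun t _ ↦ hL ▸ Subfield.subset_closure (.inr ⟨f t, rfl⟩)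
  have halg : ∀ x ∈ L, IsAlgebraic K x := by
    suffices h : L ≤ (algebraicClosure K ℂ).toSubfield from
      fun x hx ↦ mem_algebraicClosure_iff.mp (h hx)
    rw [hL, Subfield.closure_le, Set.union_subset_iff]
    constructor
    · intro x hx
      have hxK : x ∈ K := hK ▸ Subfield.subset_closure (.inl hx)
      exact mem_algebraicClosure_iff.mpr (isAlgebraic_algebraMap (⟨x, hxK⟩ : K))
    · rintro _ ⟨i, rfl⟩
      have hpow : p i ^ n ∈ K := hK ▸ Subfield.subset_closure (.inr ⟨fun _ ↦ i, by simp⟩)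
      exact mem_algebraicClosure_iff.mpr
        (.of_pow hn (isAlgebraic_algebraMap (⟨p i ^ n, hpow⟩ : K)))
  refine ⟨halg, ?_⟩
  let : Algebra K L := (Subfield.inclusion hKL).toAlgebra
  have : IsScalarTower K L ℂ := .of_algebraMap_eq fun _ ↦ rfl
  have : Algebra.IsAlgebraic K L :=
    ⟨fun x ↦ (isAlgebraic_algebraMap_iff (algebraMap L ℂ).injective).mp (halg x x.2)⟩
  have hadd := trdeg_add_eq ℚ K (A := L)
  rw [trdeg_eq_zero (R := K), add_zero] at hadd
  simpa only [trdeg_eq_algebra_trdeg] using hadd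
end

section
/- Let p₁₁, p₁₂, p₂₁, p₂₂ be four complex numbers. Let K be the subfield of ℂ generated over ℚ̄ by the sixteen products p_{ij} * p_{kl} (for 1 ≤ i, j, k, l ≤ 2), and let L be the subfield of ℂ generated over ℚ̄ by p₁₁, p₁₂, p₂₁, p₂₂. Then K ⊆ L, the extension L/K is algebraic, and the transcendence degree of K over ℚ equals the transcendence degree of L over ℚ. -/
/-- Subfields of `ℂ`, one algebraic over the other, have the same transcendence degree over `ℚ`. -/
theorem trdeg_eq_of_isAlgebraic {K L : Subfield ℂ} (hKL : K ≤ L)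
    (halg : ∀ x : ℂ, x ∈ L → IsAlgebraic K x) : trdeg ℚ K = trdeg ℚ L := by
  let : Algebra K L := (Subfield.inclusion hKL).toAlgebra
  have : IsScalarTower K L ℂ := IsScalarTower.of_algebraMap_eq fun _ => rfl
  have : IsScalarTower ℚ K L := IsScalarTower.of_algebraMap_eq fun q => by simp
  have : Algebra.IsAlgebraic K L :=
    ⟨fun x => (isAlgebraic_algebraMap_iff (algebraMap L ℂ).injective).1 (halg x x.2)⟩
  have : FaithfulSMul K L :=
    (faithfulSMul_iff_algebraMap_injective K L).2 (algebraMap K L).injective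
  have h := trdeg_add_eq ℚ K (A := L)
  rw [trdeg_eq_zero (R := K), add_zero] at h
  exact h

theorem stmt_3 (p : Fin 2 → Fin 2 → ℂ) (K L : Subfield ℂ)
    (hK : K = Subfield.closure
      (Qbar ∪ {z : ℂ | ∃ i j k l : Fin 2, z = p i j * p k l}))
    (hL : L = Subfield.closure (Qbar ∪ {z : ℂ | ∃ i j : Fin 2, z = p i j})) :
    K ≤ L ∧ (∀ x : ℂ, x ∈ L → IsAlgebraic K x) ∧ trdeg ℚ K = trdeg ℚ L := by
  have hKL : K ≤ L := by
    rw [hK, Subfield.closure_le]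
    have hsub : Qbar ∪ {z : ℂ | ∃ i j : Fin 2, z = p i j} ⊆ L := hL ▸ Subfield.subset_closure
    rintro z (hz | ⟨i, j, k, l, rfl⟩)
    · exact hsub (Or.inl hz)
    · exact L.mul_mem (hsub (Or.inr ⟨i, j, rfl⟩)) (hsub (Or.inr ⟨k, l, rfl⟩))
  have hsubK : Qbar ∪ {z : ℂ | ∃ i j k l : Fin 2, z = p i j * p k l} ⊆ K :=
    hK ▸ Subfield.subset_closure
  have halg : ∀ x : ℂ, x ∈ L → IsAlgebraic K x := by
    suffices L ≤ (algebraicClosure K ℂ).toSubfield from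
      fun x hx => mem_algebraicClosure_iff.1 (this hx)
    rw [hL, Subfield.closure_le]
    rintro z (hz | ⟨i, j, rfl⟩)
    · exact mem_algebraicClosure_iff.2
        (isAlgebraic_algebraMap (⟨z, hsubK (Or.inl hz)⟩ : K))
    · refine mem_algebraicClosure_iff.2 (IsAlgebraic.of_pow two_pos ?_)
      rw [pow_two]
      exact isAlgebraic_algebraMap
        (⟨p i j * p i j, hsubK (Or.inr ⟨i, j, i, j, rfl⟩)⟩ : K)
  exact ⟨hKL, halg, trdeg_eq_of_isAlgebraic hKL halg⟩
end
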